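/- arXiv:2008.03475 — 3 statements merged into one kernel-verified Lean document; each statement's English description precedes it below -/
import Mathlib

section
/- Let ε > 0 and Δ > 0 be real numbers and let a, b ∈ ℝ satisfy |a − b| ≤ Δ. Let μ_a and μ_b be the measures on ℝ obtained from Lebesgue measure via the densities x ↦ (ε/(2Δ))·exp(−ε·|x − a|/Δ) and x ↦ (ε/(2Δ))·exp(−ε·|x − b|/Δ), respectively. Then for every measurable set S ⊆ ℝ, μ_a(S) ≤ exp(ε) · μ_b(S). -/
open MeasureTheory

/-- Moving the center of a Laplace density by at most `Δ` changes it by a factor at most `exp ε`. -/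
lemma laplace_density_le {ε Δ a b : ℝ} (hε : 0 < ε) (hΔ : 0 < Δ) (hab : |a - b| ≤ Δ) (x : ℝ) :
    ε / (2 * Δ) * Real.exp (-ε * |x - a| / Δ) ≤
      Real.exp ε * (ε / (2 * Δ) * Real.exp (-ε * |x - b| / Δ)) := by
  rw [mul_left_comm, ← Real.exp_add]
  gcongr
  rw [div_le_iff₀ hΔ, add_mul, div_mul_cancel₀ _ hΔ.ne']
  have hx : |x - b| ≤ |x - a| + Δ := (abs_sub_le x a b).trans (by gcongr)
  linarith [mul_le_mul_of_nonneg_left hx hε.le]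

/-- The Laplace mechanism satisfies ε-differential privacy: for centers `a`, `b`
with `|a - b| ≤ Δ`, the Laplace output distributions satisfy
`μ_a S ≤ exp ε * μ_b S` for every measurable set `S`. -/
theorem laplace_mechanism_dp
    (ε Δ a b : ℝ) (hε : 0 < ε) (hΔ : 0 < Δ) (hab : |a - b| ≤ Δ)
    (μa μb : Measure ℝ)
    (hμa : μa = volume.withDensity
      (fun x => ENNReal.ofReal (ε / (2 * Δ) * Real.exp (-ε * |x - a| / Δ))))
    (hμb : μb = volume.withDensity
      (fun x => ENNReal.ofReal (ε / (2 * Δ) * Real.exp (-ε * |x - b| / Δ)))) :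
    ∀ S : Set ℝ, MeasurableSet S → μa S ≤ ENNReal.ofReal (Real.exp ε) * μb S := by
  subst hμa hμb
  intro S hS
  rw [withDensity_apply _ hS, withDensity_apply _ hS,
    ← lintegral_const_mul' _ _ ENNReal.ofReal_ne_top]
  refine lintegral_mono fun x => ?_
  rw [← ENNReal.ofReal_mul (Real.exp_pos ε).le]
  exact ENNReal.ofReal_le_ofReal (laplace_density_le hε hΔ hab x)
end

section
/- Let μ and ν be probability measures on a measurable space X satisfying the ε₁-DP inequality, i.e. μ(S) ≤ exp(ε₁)·ν(S) for every measurable set S, and let κ and η be Markov kernels from X to a measurable space Y such that for every x ∈ X the pair (κ(x), η(x)) satisfies the ε₂-DP inequality, i.e. κ(x)(T) ≤ exp(ε₂)·η(x)(T) for every measurable set T ⊆ Y. Then the bind measures μ.bind κ and ν.bind η on Y satisfy (μ.bind κ)(T) ≤ exp(ε₁ + ε₂)·(ν.bind η)(T) for every measurable set T ⊆ Y. -/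
open MeasureTheory ProbabilityTheory

/-- Adaptive sequential composition for differential privacy: if `(μ, ν)`
satisfies the ε₁-DP inequality and for every `x` the kernel pair `(κ x, η x)`
satisfies the ε₂-DP inequality, then the bind measures satisfy the
(ε₁ + ε₂)-DP inequality. -/
theorem sequential_composition_dp
    {X Y : Type*} [MeasurableSpace X] [MeasurableSpace Y]
    (ε₁ ε₂ : ℝ)
    (μ ν : Measure X) [IsProbabilityMeasure μ] [IsProbabilityMeasure ν]
    (κ η : Kernel X Y) [IsMarkovKernel κ] [IsMarkovKernel η]
    (h₁ : ∀ S : Set X, MeasurableSet S → μ S ≤ ENNReal.ofReal (Real.exp ε₁) * ν S)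
    (h₂ : ∀ x : X, ∀ T : Set Y, MeasurableSet T →
      κ x T ≤ ENNReal.ofReal (Real.exp ε₂) * η x T) :
    ∀ T : Set Y, MeasurableSet T →
      (μ.bind κ) T ≤ ENNReal.ofReal (Real.exp (ε₁ + ε₂)) * (ν.bind η) T := by
  intro T hT
  have hle : μ ≤ ENNReal.ofReal (Real.exp ε₁) • ν :=
    Measure.le_iff.2 fun S hS => by simpa using h₁ S hS
  rw [Measure.bind_apply hT κ.aemeasurable, Measure.bind_apply hT η.aemeasurable]
  calc ∫⁻ x, κ x T ∂μ
      ≤ ∫⁻ x, ENNReal.ofReal (Real.exp ε₂) * η x T ∂(ENNReal.ofReal (Real.exp ε₁) • ν) :=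
        lintegral_mono' hle fun x => h₂ x T hT
    _ = ENNReal.ofReal (Real.exp (ε₁ + ε₂)) * ∫⁻ x, η x T ∂ν := by
        rw [lintegral_smul_measure, lintegral_const_mul _ (η.measurable_coe hT), smul_eq_mul,
          ← mul_assoc, ← ENNReal.ofReal_mul (Real.exp_nonneg _), ← Real.exp_add]
end

section
/- Let I be a finite index set, and for each i ∈ I let μᵢ and νᵢ be probability measures on a measurable space Xᵢ and let εᵢ ≥ 0 be such that the pair (μᵢ, νᵢ) satisfies the εᵢ-DP inequality, i.e. μᵢ(S) ≤ exp(εᵢ)·νᵢ(S) for every measurable set S ⊆ Xᵢ. Then the product measures satisfy (⊗ᵢ μᵢ)(S) ≤ exp(∑ᵢ εᵢ) · (⊗ᵢ νᵢ)(S) for every measurable set S in the product space ∏ᵢ Xᵢ. -/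
open MeasureTheory

/-- Domination up to finite nonzero constants passes to finite product measures, the constants being
multiplied. -/
theorem pi_le_prod_smul_pi {I : Type*} [Fintype I] {X : I → Type*} [∀ i, MeasurableSpace (X i)]
    {μ ν : ∀ i, Measure (X i)} [∀ i, SigmaFinite (μ i)] {c : I → ENNReal}
    (hc₀ : ∀ i, c i ≠ 0) (hc : ∀ i, c i ≠ ⊤) (h : ∀ i, μ i ≤ c i • ν i) :
    Measure.pi μ ≤ (∏ i, c i) • Measure.pi ν := by
  have hC₀ : ∏ i, c i ≠ 0 := Finset.prod_ne_zero_iff.2 fun i _ => hc₀ i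
  have hC : ∏ i, c i ≠ ⊤ := ENNReal.prod_ne_top fun i _ => hc i
  have key : (∏ i, c i)⁻¹ • (Measure.pi μ).toOuterMeasure ≤
      OuterMeasure.pi fun i => (ν i).toOuterMeasure := by
    rw [OuterMeasure.le_pi]
    intro s _
    change (∏ i, c i)⁻¹ * Measure.pi μ (Set.univ.pi s) ≤ ∏ i, ν i (s i)
    rw [Measure.pi_pi, ENNReal.inv_mul_le_iff hC₀ hC, ← Finset.prod_mul_distrib]
    exact Finset.prod_le_prod' fun i _ => h i (s i)
  refine Measure.le_iff.2 fun S hS => ?_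
  rw [Measure.smul_apply, smul_eq_mul, ← ENNReal.inv_mul_le_iff hC₀ hC, Measure.pi_def ν,
    toMeasure_apply _ _ hS]
  exact key S

/-- Sequential composition for differential privacy (independent randomness):
if each pair `(μ i, ν i)` satisfies the `ε i`-DP inequality, then the product
measures satisfy the `(∑ i, ε i)`-DP inequality. -/
theorem sequential_composition_product_dp
    {I : Type*} [Fintype I] {X : I → Type*} [∀ i, MeasurableSpace (X i)]
    (ε : I → ℝ) (hε : ∀ i, 0 ≤ ε i)
    (μ ν : ∀ i, Measure (X i))
    [∀ i, IsProbabilityMeasure (μ i)] [∀ i, IsProbabilityMeasure (ν i)]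
    (h : ∀ i, ∀ S : Set (X i), MeasurableSet S →
      μ i S ≤ ENNReal.ofReal (Real.exp (ε i)) * ν i S) :
    ∀ S : Set (∀ i, X i), MeasurableSet S →
      Measure.pi μ S ≤ ENNReal.ofReal (Real.exp (∑ i, ε i)) * Measure.pi ν S := by
  intro S _
  rw [Real.exp_sum, ENNReal.ofReal_prod_of_nonneg fun i _ => (Real.exp_pos (ε i)).le]
  exact pi_le_prod_smul_pi (fun i => by simp [Real.exp_pos]) (fun _ => ENNReal.ofReal_ne_top)
    (fun i => Measure.le_iff.2 (h i)) S
end
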